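/- Let B be a unital complex Banach algebra, take I = {1,2} in the Fock-space construction, let α₀, β₀ ∈ B be invertible, let N ≥ 1, choose bounded n-multilinear maps α_n, β_n : Bⁿ → B for n ∈ {1,…,N}, and set F(b) = α₀ + Σ_{n=1}^{N} α_n(b,…,b) and G(b) = β₀ + Σ_{n=1}^{N} β_n(b,…,b). Let X = Σ_{n=0}^{N} (V_{1,n}(α_n) + W_{1,n}(α_n)) and Y = Σ_{n=0}^{N} (V_{2,n}(β_n) + W_{2,n}(β_n)) in B(𝔉). Then, with respect to the expectation ℰ, the S-transform of XY satisfies, for all b in a neighborhood of 0 in B, S_{XY}(b) = G(b)^{-1} F(G(b) b G(b)^{-1})^{-1} = S_Y(b) S_X(S_Y(b)^{-1} b S_Y(b)). -/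

import Mathlib

open scoped Topology ENNReal

noncomputable section

variable (B : Type*) [NormedRing B] [NormedAlgebra ℂ B] [CompleteSpace B]
variable (I : Type*) [DecidableEq I]

abbrev D := lp (fun _ : I => B) 1

def delta (i : I) : D B I := lp.single 1 i (1 : B)

def lsmul (b : B) (d : D B I) : D B I :=
  ⟨fun i => b * d i, by
    apply memℓp_gen
    have h1 : Summable fun i => ‖d i‖ ^ (1 : ℝ≥0∞).toReal :=
      (lp.memℓp d).summable (by norm_num)
    simp only [ENNReal.toReal_one, Real.rpow_one] at h1 ⊢
    exact Summable.of_nonneg_of_le (fun i => norm_nonneg _)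
      (fun i => norm_mul_le b (d i)) (h1.mul_left ‖b‖)⟩

/-- The Fock-space construction of Dykema's paper: `F` plays the role of
`𝔉 = BΩ ⊕ ⨁_{k ≥ 1} D^{⊗̂k} ⊗̂ B`, with `τ k d b₀` the elementary tensor
`d 0 ⊗ ⋯ ⊗ d k ⊗ b₀` (`k+1` factors from `D`), `lam` the left action of `B`,
`rho` the right action of `B`, `P` the projection onto `BΩ` and the operators
`L i`, `V i n αₙ`, `W i n αₙ` as defined in the paper. -/
structure FockSetup (F : Type*) [NormedAddCommGroup F] [NormedSpace ℂ F] [CompleteSpace F] where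
  Ω : F
  τ : (k : ℕ) → (Fin (k + 1) → D B I) → B → F
  lam : B →ₐ[ℂ] (F →L[ℂ] F)
  rho : B → (F →L[ℂ] F)
  P : F →L[ℂ] B
  L : I → (F →L[ℂ] F)
  V : (i : I) → (n : ℕ) → ContinuousMultilinearMap ℂ (fun _ : Fin n => B) B → (F →L[ℂ] F)
  W : (i : I) → (n : ℕ) → ContinuousMultilinearMap ℂ (fun _ : Fin n => B) B → (F →L[ℂ] F)
  dense_span : Dense (↑(Submodule.span ℂ
      ((Set.range fun b : B => lam b Ω) ∪
        {x | ∃ (k : ℕ) (d : Fin (k + 1) → D B I) (b₀ : B), x = τ k d b₀})) : Set F)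
  lam_tensor : ∀ (b : B) (k : ℕ) (d : Fin (k + 1) → D B I) (b₀ : B),
    lam b (τ k d b₀) = τ k (Function.update d 0 (lsmul B I b (d 0))) b₀
  rho_lam_omega : ∀ b b₀ : B, rho b (lam b₀ Ω) = lam (b₀ * b) Ω
  rho_tensor : ∀ (b : B) (k : ℕ) (d : Fin (k + 1) → D B I) (b₀ : B),
    rho b (τ k d b₀) = τ k d (b₀ * b)
  P_lam_omega : ∀ b : B, P (lam b Ω) = b
  P_tensor : ∀ (k : ℕ) (d : Fin (k + 1) → D B I) (b₀ : B), P (τ k d b₀) = 0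
  L_omega : ∀ (i : I) (b₀ : B), L i (lam b₀ Ω) = τ 0 (fun _ => delta B I i) b₀
  L_tensor : ∀ (i : I) (k : ℕ) (d : Fin (k + 1) → D B I) (b₀ : B),
    L i (τ k d b₀) = τ (k + 1) (Fin.cons (delta B I i) d) b₀
  V_zero : ∀ (i : I) (α : ContinuousMultilinearMap ℂ (fun _ : Fin 0 => B) B),
    V i 0 α = lam (α 0)
  W_zero : ∀ (i : I) (α : ContinuousMultilinearMap ℂ (fun _ : Fin 0 => B) B),
    W i 0 α = lam (α 0) * L i
  V_omega : ∀ (i : I) (n : ℕ), 1 ≤ n →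
    ∀ (α : ContinuousMultilinearMap ℂ (fun _ : Fin n => B) B) (b₀ : B),
      V i n α (lam b₀ Ω) = 0
  W_omega : ∀ (i : I) (n : ℕ), 1 ≤ n →
    ∀ (α : ContinuousMultilinearMap ℂ (fun _ : Fin n => B) B) (b₀ : B),
      W i n α (lam b₀ Ω) = 0
  V_tensor_lt : ∀ (i : I) (n : ℕ) (α : ContinuousMultilinearMap ℂ (fun _ : Fin n => B) B)
      (k : ℕ) (d : Fin (k + 1) → D B I) (b₀ : B), k + 1 < n →
    V i n α (τ k d b₀) = 0
  W_tensor_lt : ∀ (i : I) (n : ℕ) (α : ContinuousMultilinearMap ℂ (fun _ : Fin n => B) B)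
      (k : ℕ) (d : Fin (k + 1) → D B I) (b₀ : B), k + 1 < n →
    W i n α (τ k d b₀) = 0
  V_tensor_eq : ∀ (i : I) (k : ℕ) (α : ContinuousMultilinearMap ℂ (fun _ : Fin (k + 1) => B) B)
      (d : Fin (k + 1) → D B I) (b₀ : B),
    V i (k + 1) α (τ k d b₀) = lam (α (fun j => d j i) * b₀) Ω
  W_tensor_eq : ∀ (i : I) (k : ℕ) (α : ContinuousMultilinearMap ℂ (fun _ : Fin (k + 1) => B) B)
      (d : Fin (k + 1) → D B I) (b₀ : B),
    W i (k + 1) α (τ k d b₀) = lam (α (fun j => d j i)) (τ 0 (fun _ => delta B I i) b₀)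
  V_tensor_gt : ∀ (i : I) (n : ℕ), 1 ≤ n →
    ∀ (α : ContinuousMultilinearMap ℂ (fun _ : Fin n => B) B)
      (k : ℕ) (d : Fin (k + 1) → D B I) (b₀ : B) (h : n ≤ k),
    V i n α (τ k d b₀) =
      lam (α fun j => d (Fin.castLE (by omega) j) i)
        (τ (k - n) (fun j : Fin (k - n + 1) => d ⟨n + (j : ℕ), by omega⟩) b₀)
  W_tensor_gt : ∀ (i : I) (n : ℕ), 1 ≤ n →
    ∀ (α : ContinuousMultilinearMap ℂ (fun _ : Fin n => B) B)
      (k : ℕ) (d : Fin (k + 1) → D B I) (b₀ : B) (h : n ≤ k),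
    W i n α (τ k d b₀) =
      lam (α fun j => d (Fin.castLE (by omega) j) i)
        (τ (k - n + 1) (Fin.cons (delta B I i)
          (fun j : Fin (k - n + 1) => d ⟨n + (j : ℕ), by omega⟩)) b₀)

variable {B} {I}
variable {F : Type*} [NormedAddCommGroup F] [NormedSpace ℂ F] [CompleteSpace F]

/-- The expectation `ℰ(X) = P(XΩ)`. -/
def FockSetup.Ec (S : FockSetup B I F) (X : F →L[ℂ] F) : B := S.P (X S.Ω)

/-- `Ψ_X(b) = ℰ((1 - bX)⁻¹) - 1` for an operator `X` on the Fock space (with `b` acting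
via `λ`). -/
def FockSetup.Psi (S : FockSetup B I F) (X : F →L[ℂ] F) (b : B) : B :=
  S.Ec (Ring.inverse (1 - S.lam b * X)) - 1

/-- `Sx` is (a version of) the S-transform of `X` with respect to `ℰ`:  `Sx(b) = (1+b) H(b)`
where `H` is analytic near `0` and `b ↦ b H(b)` is a local right inverse of `Ψ_X`. -/
def FockSetup.IsSTransform (S : FockSetup B I F) (X : F →L[ℂ] F) (Sx : B → B) : Prop :=
  ∃ H : B → B, AnalyticAt ℂ H 0 ∧ (∀ᶠ b in nhds (0 : B), S.Psi X (b * H b) = b) ∧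
    ∀ᶠ b in nhds (0 : B), Sx b = (1 + b) * H b

theorem Submodule.exists_dual_eq_one_of_notMem {E : Type*} [NormedAddCommGroup E]
    [NormedSpace ℂ E] {s : Submodule ℂ E} (hs : IsClosed (s : Set E)) {x : E} (hx : x ∉ s) :
    ∃ f : E →L[ℂ] ℂ, f x = 1 ∧ ∀ y ∈ s, f y = 0 := by
  have : IsClosed (s : Set E) := hs
  have hne : s.mkQL x ≠ 0 := fun h => hx ((Submodule.Quotient.mk_eq_zero s).1 h)
  obtain ⟨g, hg⟩ := SeparatingDual.exists_eq_one (R := ℂ) hne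
  refine ⟨g.comp s.mkQL, hg, fun y hy => ?_⟩
  have h0 : s.mkQL y = 0 := (Submodule.Quotient.mk_eq_zero s).2 hy
  rw [ContinuousLinearMap.comp_apply, h0, map_zero]

theorem exists_triangular_dual_seq (E : Type*) [NormedAddCommGroup E] [NormedSpace ℂ E]
    (hE : ¬ FiniteDimensional ℂ E) :
    ∃ (x : ℕ → E) (f : ℕ → E →L[ℂ] ℂ), (∀ n, f n (x n) = 1) ∧ ∀ m n, n < m → f m (x n) = 0 := by
  let b := Module.Basis.ofVectorSpace ℂ E
  have hinf : Infinite (Module.Basis.ofVectorSpaceIndex ℂ E) := by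
    by_contra h
    have := not_infinite_iff_finite.1 h
    exact hE (Module.Finite.of_basis b)
  let e := Infinite.natEmbedding (Module.Basis.ofVectorSpaceIndex ℂ E)
  have hli : LinearIndependent ℂ fun n => b (e n) := b.linearIndependent.comp e e.injective
  have hf : ∀ n, ∃ f : E →L[ℂ] ℂ, f (b (e n)) = 1 ∧ ∀ m < n, f (b (e m)) = 0 := by
    intro n
    let s : Submodule ℂ E := Submodule.span ℂ ((fun k => b (e k)) '' Set.Iio n)
    have : FiniteDimensional ℂ s :=
      FiniteDimensional.span_of_finite ℂ ((Set.finite_Iio n).image _)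
    have hs : IsClosed (s : Set E) := s.closed_of_finiteDimensional
    have hns : b (e n) ∉ s := hli.notMem_span_image (by simp)
    obtain ⟨f, h1, h0⟩ := Submodule.exists_dual_eq_one_of_notMem hs hns
    exact ⟨f, h1, fun m hm => h0 _ (Submodule.subset_span (Set.mem_image_of_mem _ hm))⟩
  choose f h1 h0 using hf
  exact ⟨fun n => b (e n), f, h1, fun m n h => h0 m n h⟩

/-- A linear map which is compatible, up to constants, with every bounded operator on its
domain is automatically bounded. -/
theorem LinearMap.exists_bound_of_comp_bound {E A : Type*} [NormedAddCommGroup E] [NormedSpace ℂ E]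
    [CompleteSpace E] [NormedAddCommGroup A] [NormedSpace ℂ A] (l : E →ₗ[ℂ] A)
    (hl : ∀ T : E →L[ℂ] E, ∃ C : ℝ, ∀ x, ‖l (T x)‖ ≤ C * ‖l x‖) :
    ∃ K : ℝ, ∀ x, ‖l x‖ ≤ K * ‖x‖ := by
  by_cases hE : FiniteDimensional ℂ E
  · exact ⟨‖LinearMap.toContinuousLinearMap l‖,
      fun x => (LinearMap.toContinuousLinearMap l).le_opNorm x⟩
  obtain ⟨x, f, h1, h0⟩ := exists_triangular_dual_seq E hE
  by_contra! hK
  have hstep : ∀ (n : ℕ) (T : E →L[ℂ] E), ∃ y : E, ‖f n‖ * ‖y‖ ≤ 1 / 2 / 2 ^ n ∧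
      n * (‖l (x n)‖ + 1) ≤ ‖l (T (x n) + y)‖ := by
    intro n T
    set ε : ℝ := 1 / 2 / 2 ^ n / (‖f n‖ + 1) with hε
    have hεpos : 0 < ε := by positivity
    set M : ℝ := n * (‖l (x n)‖ + 1) + ‖l (T (x n))‖ with hM
    have hMnn : 0 ≤ M := by positivity
    obtain ⟨z, hz⟩ := hK (M / ε)
    have hz0 : 0 < ‖z‖ := by
      rcases eq_or_ne z 0 with rfl | h
      · simp at hz
      · simpa using h
    refine ⟨((ε / ‖z‖ : ℝ) : ℂ) • z, ?_, ?_⟩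
    · rw [norm_smul, Complex.norm_real, Real.norm_of_nonneg (by positivity),
        div_mul_cancel₀ _ hz0.ne', hε, mul_div_assoc', div_le_iff₀ (by positivity)]
      have : (0 : ℝ) < 1 / 2 / 2 ^ n := by positivity
      nlinarith [norm_nonneg (f n)]
    · have h2 : M ≤ ‖l (((ε / ‖z‖ : ℝ) : ℂ) • z)‖ := by
        rw [map_smul, norm_smul, Complex.norm_real, Real.norm_of_nonneg (by positivity)]
        calc M = ε / ‖z‖ * (M / ε * ‖z‖) := by field_simp
          _ ≤ _ := by gcongr
      have h3 := norm_sub_le_norm_add (l (((ε / ‖z‖ : ℝ) : ℂ) • z)) (l (T (x n)))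
      rw [map_add, add_comm (l (T (x n)))]
      linarith
  choose y hy1 hy2 using hstep
  let T : ℕ → E →L[ℂ] E := fun n =>
    Nat.rec 0 (fun k S => S + (f k).smulRight (y k S)) n
  have hT : ∀ n, T (n + 1) = T n + (f n).smulRight (y n (T n)) := fun n => rfl
  have hd : ∀ n, dist (T n) (T (n + 1)) ≤ 1 / 2 / 2 ^ n := by
    intro n
    rw [hT, dist_self_add_right, ContinuousLinearMap.norm_smulRight_apply]
    exact hy1 n (T n)
  obtain ⟨U, hU⟩ := cauchySeq_tendsto_of_complete (cauchySeq_of_le_geometric_two hd)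
  have hconst : ∀ n k, T (n + 1 + k) (x n) = T (n + 1) (x n) := by
    intro n k
    induction k with
    | zero => rfl
    | succ k ih =>
      rw [← add_assoc, hT, _root_.add_apply, ih,
        ContinuousLinearMap.smulRight_apply, h0 _ _ (by omega), zero_smul, add_zero]
  have hUx : ∀ n, U (x n) = T n (x n) + y n (T n) := by
    intro n
    have hlim : Filter.Tendsto (fun k => T k (x n)) Filter.atTop (𝓝 (U (x n))) :=
      ((ContinuousLinearMap.apply ℂ E (x n)).continuous.tendsto U).comp hU
    have hev : (fun k => T k (x n)) =ᶠ[Filter.atTop] fun _ => T (n + 1) (x n) := by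
      filter_upwards [Filter.eventually_ge_atTop (n + 1)] with k hk
      obtain ⟨j, rfl⟩ := Nat.exists_eq_add_of_le hk
      exact hconst n j
    rw [tendsto_nhds_unique (hlim.congr' hev) tendsto_const_nhds, hT,
      _root_.add_apply, ContinuousLinearMap.smulRight_apply, h1, one_smul]
  obtain ⟨C, hC⟩ := hl U
  obtain ⟨n, hn⟩ := exists_nat_gt (max C 0)
  have h2 := hy2 n (T n)
  rw [← hUx] at h2
  have h3 := hC (x n)
  have hn1 := (le_max_left C 0).trans_lt hn
  have hn2 := (le_max_right C 0).trans_lt hn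
  nlinarith [norm_nonneg (l (x n))]

/-- An analytic germ annihilated by left multiplication by the variable vanishes. -/
theorem AnalyticAt.eventually_eq_zero_of_mul_eq_zero {B : Type*} [NormedRing B] [NormedAlgebra ℂ B]
    [CompleteSpace B] {H : B → B} (hH : AnalyticAt ℂ H 0) (h : ∀ᶠ b in 𝓝 (0 : B), b * H b = 0) :
    ∀ᶠ b in 𝓝 (0 : B), H b = 0 := by
  obtain ⟨r, hr, hball⟩ := Metric.eventually_nhds_iff.1 (hH.eventually_analyticAt.and h)
  set ρ : ℝ := r / 2 / (‖(1 : B)‖ + 1) with hρ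
  have hρ0 : 0 < ρ := by positivity
  have hmem : ∀ b : B, ‖b‖ < r / 2 → ∀ z : ℂ, ‖z‖ < ρ → dist (b + z • (1 : B)) 0 < r := by
    intro b hb z hz
    rw [dist_zero_right]
    have h1 : ‖z • (1 : B)‖ ≤ r / 2 := by
      rw [norm_smul]
      calc ‖z‖ * ‖(1 : B)‖ ≤ ρ * (‖(1 : B)‖ + 1) := by gcongr; linarith
        _ = r / 2 := by rw [hρ]; field_simp
    linarith [norm_add_le b (z • (1 : B))]
  filter_upwards [Metric.ball_mem_nhds (0 : B) (half_pos hr), Metric.ball_mem_nhds (0 : B) hρ0]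
    with b hb1 hb2
  rw [mem_ball_zero_iff] at hb1 hb2
  have han : AnalyticOnNhd ℂ (fun z : ℂ => H (b + z • (1 : B))) (Metric.ball 0 ρ) := by
    intro z hz
    have h1 : AnalyticAt ℂ (fun z : ℂ => b + z • (1 : B)) z := by fun_prop
    exact AnalyticAt.comp (g := H) (hball (hmem b hb1 z (mem_ball_zero_iff.1 hz))).1 h1
  obtain ⟨t, ht1, ht2⟩ := exists_between hb2
  have ht0 : 0 < t := (norm_nonneg b).trans_lt ht1
  have hz₀ : ((t : ℝ) : ℂ) ∈ Metric.ball (0 : ℂ) ρ := by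
    rw [mem_ball_zero_iff, Complex.norm_real, Real.norm_of_nonneg ht0.le]; exact ht2
  have hev : (fun z : ℂ => H (b + z • (1 : B))) =ᶠ[𝓝 (t : ℂ)] 0 := by
    have hopen : IsOpen {z : ℂ | ‖b‖ < ‖z‖} := isOpen_lt continuous_const continuous_norm
    filter_upwards [hopen.mem_nhds (by simpa [abs_of_pos ht0] using ht1),
      Metric.isOpen_ball.mem_nhds hz₀] with z hz1 hz2
    have hz0 : z ≠ 0 := norm_pos_iff.1 ((norm_nonneg b).trans_lt hz1)
    have hu : IsUnit (b + z • (1 : B)) := by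
      have h1 : IsUnit (1 - (-(z⁻¹ • b))) := isUnit_one_sub_of_norm_lt_one (by
        rw [norm_neg, norm_smul, norm_inv, inv_mul_lt_iff₀ (by simpa using hz0), mul_one]
        exact hz1)
      have h2 : b + z • (1 : B) = (Units.mk0 z hz0) • (1 - (-(z⁻¹ • b))) := by
        rw [Units.smul_def, Units.val_mk0, sub_neg_eq_add, smul_add, smul_inv_smul₀ hz0, add_comm]
      rw [h2]
      exact h1.smul _
    have h3 := (hball (hmem b hb1 z (mem_ball_zero_iff.1 hz2))).2
    exact (hu.mul_right_eq_zero).1 h3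
  have := han.eqOn_zero_of_preconnected_of_eventuallyEq_zero
    (convex_ball 0 ρ).isPreconnected hz₀ hev (Metric.mem_ball_self hρ0)
  simpa using this

/-- Two continuous local right inverses of the same map agree near a point if one of them has
an invertible strict derivative. -/
theorem HasStrictFDerivAt.eventually_eq_of_right_inverse {E : Type*} [NormedAddCommGroup E]
    [NormedSpace ℂ E] [CompleteSpace E] {p c d : E → E} {c' : E ≃L[ℂ] E}
    (hc : HasStrictFDerivAt c (c' : E →L[ℂ] E) 0) (hc0 : c 0 = 0)
    (hpc : ∀ᶠ b in 𝓝 (0 : E), p (c b) = b) (hd : Filter.Tendsto d (𝓝 0) (𝓝 0))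
    (hpd : ∀ᶠ b in 𝓝 (0 : E), p (d b) = b) : ∀ᶠ b in 𝓝 (0 : E), d b = c b := by
  have he : Filter.Tendsto (fun b => hc.localInverse c c' 0 (d b)) (𝓝 0) (𝓝 0) := by
    have := hc.localInverse_tendsto
    rw [hc0] at this
    exact this.comp hd
  have hr := hc.eventually_right_inverse
  rw [hc0] at hr
  filter_upwards [hd.eventually hr, he.eventually hpc, hpd] with b h1 h2 h3
  rw [h1, h3] at h2
  rw [← h1, ← h2]

set_option linter.unusedSectionVars false

namespace FockSetup

variable (S : FockSetup B I F)

theorem clm_ext {E : Type*} [NormedAddCommGroup E] [NormedSpace ℂ E] {T₁ T₂ : F →L[ℂ] E}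
    (hΩ : ∀ b, T₁ (S.lam b S.Ω) = T₂ (S.lam b S.Ω))
    (hτ : ∀ k d b, T₁ (S.τ k d b) = T₂ (S.τ k d b)) : T₁ = T₂ := by
  refine ContinuousLinearMap.ext_on S.dense_span ?_
  rintro x (⟨b, rfl⟩ | ⟨k, d, b, rfl⟩)
  exacts [hΩ b, hτ k d b]

theorem lam_mul_apply (b c : B) (u : F) : S.lam (b * c) u = S.lam b (S.lam c u) := by
  rw [map_mul]; rfl

theorem P_lam (b : B) (u : F) : S.P (S.lam b u) = b * S.P u := by
  have h : S.P.comp (S.lam b) = (ContinuousLinearMap.mul ℂ B b).comp S.P :=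
    S.clm_ext
      (fun c => by
        change S.P (S.lam b (S.lam c S.Ω)) = b * S.P (S.lam c S.Ω)
        rw [← S.lam_mul_apply, S.P_lam_omega, S.P_lam_omega])
      (fun k d c => by
        change S.P (S.lam b (S.τ k d c)) = b * S.P (S.τ k d c)
        rw [S.lam_tensor, S.P_tensor, S.P_tensor, mul_zero])
  exact congrArg (fun T : F →L[ℂ] B => T u) h

theorem P_L (i : I) (u : F) : S.P (S.L i u) = 0 := by
  have h : S.P.comp (S.L i) = 0 :=
    S.clm_ext
      (fun c => by
        change S.P (S.L i (S.lam c S.Ω)) = 0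
        rw [S.L_omega, S.P_tensor])
      (fun k d c => by
        change S.P (S.L i (S.τ k d c)) = 0
        rw [S.L_tensor, S.P_tensor])
  exact congrArg (fun T : F →L[ℂ] B => T u) h

theorem τ_congr {k k' : ℕ} (h : k = k') {d : Fin (k + 1) → D B I} {d' : Fin (k' + 1) → D B I}
    (hd : ∀ j : Fin (k + 1), d j = d' (Fin.cast (by rw [h]) j)) (b : B) :
    S.τ k d b = S.τ k' d' b := by
  subst h
  rw [show d = d' from funext hd]

theorem lsmul_delta_apply (x : B) (i j : I) :
    lsmul B I x (delta B I j) i = if j = i then x else 0 := by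
  change x * (delta B I j) i = _
  rw [delta, lp.single_apply]
  by_cases h : j = i
  · subst h; simp
  · rw [if_neg h, Pi.single_eq_of_ne (Ne.symm h), mul_zero]

theorem lam_L_omega (x : B) (j : I) (c : B) :
    S.lam x (S.L j (S.lam c S.Ω)) = S.τ 0 (fun _ => lsmul B I x (delta B I j)) c := by
  rw [S.L_omega, S.lam_tensor]
  congr 1
  ext1 m
  rw [Subsingleton.elim (α := Fin 1) m 0, Function.update_self]

theorem lam_L_tensor (x : B) (j : I) (k : ℕ) (d : Fin (k + 1) → D B I) (c : B) :
    S.lam x (S.L j (S.τ k d c)) = S.τ (k + 1) (Fin.cons (lsmul B I x (delta B I j)) d) c := by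
  rw [S.L_tensor, S.lam_tensor, Fin.cons_zero, Fin.update_cons_zero]

theorem cons_lsmul_delta_apply (i j : I) (x : B) (k : ℕ) (d : Fin (k + 1) → D B I) :
    (fun m => (Fin.cons (lsmul B I x (delta B I j)) d : Fin (k + 1 + 1) → D B I) m i) =
      Fin.cons (if j = i then x else 0) fun m => d m i := by
  ext m
  refine Fin.cases ?_ (fun m => ?_) m
  · rw [Fin.cons_zero, Fin.cons_zero, lsmul_delta_apply]
  · rw [Fin.cons_succ, Fin.cons_succ]

/-- Operators of the type of `V i n α` and `W i n α` (for `Q = 1` and `Q = L i` respectively)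
strip one leading letter at a time. -/
theorem strip_letter (i j : I) (Q : F →L[ℂ] F)
    (Z : (n : ℕ) → ContinuousMultilinearMap ℂ (fun _ : Fin n => B) B → (F →L[ℂ] F))
    (hzero : ∀ α, Z 0 α = S.lam (α 0) * Q)
    (hΩ : ∀ n, 1 ≤ n → ∀ α c, Z n α (S.lam c S.Ω) = 0)
    (hlt : ∀ n α k d c, k + 1 < n → Z n α (S.τ k d c) = 0)
    (heq : ∀ k (α : ContinuousMultilinearMap ℂ (fun _ : Fin (k + 1) => B) B) d c,
      Z (k + 1) α (S.τ k d c) = S.lam (α fun m => d m i) (Q (S.lam c S.Ω)))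
    (hgt : ∀ n, 1 ≤ n → ∀ (α : ContinuousMultilinearMap ℂ (fun _ : Fin n => B) B) k
      (d : Fin (k + 1) → D B I) (c : B) (h : n ≤ k),
      Z n α (S.τ k d c) = S.lam (α fun m => d (Fin.castLE (by omega) m) i)
        (Q (S.τ (k - n) (fun m : Fin (k - n + 1) => d ⟨n + (m : ℕ), by omega⟩) c)))
    (n : ℕ) (α : ContinuousMultilinearMap ℂ (fun _ : Fin (n + 1) => B) B) (x : B) (u : F) :
    Z (n + 1) α (S.lam x (S.L j u)) = Z n (α.curryLeft (if j = i then x else 0)) u := by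
  have h : (Z (n + 1) α).comp ((S.lam x).comp (S.L j)) =
      Z n (α.curryLeft (if j = i then x else 0)) := by
    refine S.clm_ext (fun c => ?_) (fun k d c => ?_)
    · change Z (n + 1) α (S.lam x (S.L j (S.lam c S.Ω))) = _
      rw [S.lam_L_omega]
      rcases n with _ | n
      · rw [heq, hzero, ContinuousMultilinearMap.curryLeft_apply, mul_apply_eq_comp]
        congr 3
        ext m
        rw [Subsingleton.elim (α := Fin 1) m 0, Fin.cons_zero, lsmul_delta_apply]
      · rw [hlt _ _ _ _ _ (by omega), hΩ _ (by omega)]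
    · change Z (n + 1) α (S.lam x (S.L j (S.τ k d c))) = _
      rw [S.lam_L_tensor]
      rcases lt_trichotomy (k + 1) n with hk | rfl | hk
      · rw [hlt _ _ _ _ _ (by omega), hlt _ _ _ _ _ hk]
      · rw [heq, heq, ContinuousMultilinearMap.curryLeft_apply, cons_lsmul_delta_apply]
      · have harg : (fun m : Fin (n + 1) => (Fin.cons (lsmul B I x (delta B I j)) d :
            Fin (k + 1 + 1) → D B I) (Fin.castLE (by omega) m) i) =
            Fin.cons (if j = i then x else 0) fun m : Fin n => d (Fin.castLE (by omega) m) i := by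
          ext m
          rw [congrFun (cons_lsmul_delta_apply i j x k d) (Fin.castLE (by omega) m)]
          exact Fin.cases rfl (fun m => rfl) m
        rw [hgt _ (by omega) _ _ _ _ (by omega), harg]
        rcases n with _ | n
        · rw [hzero, ContinuousMultilinearMap.curryLeft_apply, mul_apply_eq_comp]
          have ht : S.τ (k + 1 - (0 + 1)) (fun m : Fin (k + 1 - (0 + 1) + 1) =>
              (Fin.cons (lsmul B I x (delta B I j)) d : Fin (k + 1 + 1) → D B I)
                ⟨0 + 1 + (m : ℕ), by omega⟩) c = S.τ k d c := by
            refine S.τ_congr (k' := k) (by omega) (fun m => ?_) c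
            rw [show (⟨0 + 1 + (m : ℕ), by omega⟩ : Fin (k + 1 + 1)) =
              Fin.succ (Fin.cast (by omega) m) from Fin.ext (by simp; omega), Fin.cons_succ]
          rw [ht]
          congr 4
          exact Subsingleton.elim (α := Fin 0 → B) _ _
        · rw [hgt _ (by omega) _ _ _ _ (by omega), ContinuousMultilinearMap.curryLeft_apply]
          congr 2
          refine S.τ_congr (by omega) (fun m => ?_) c
          rw [show (⟨n + 1 + 1 + (m : ℕ), by omega⟩ : Fin (k + 1 + 1)) =
            Fin.succ ⟨n + 1 + (m : ℕ), by omega⟩ from Fin.ext (by simp; omega), Fin.cons_succ]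
          rfl
  exact congrArg (fun T : F →L[ℂ] F => T u) h

theorem V_lam_L (i j : I) (n : ℕ) (α : ContinuousMultilinearMap ℂ (fun _ : Fin (n + 1) => B) B)
    (x : B) (u : F) :
    S.V i (n + 1) α (S.lam x (S.L j u)) = S.V i n (α.curryLeft (if j = i then x else 0)) u :=
  S.strip_letter i j 1 (S.V i) (fun α => by rw [S.V_zero, mul_one]) (S.V_omega i)
    (S.V_tensor_lt i) (fun k α d c => by rw [S.V_tensor_eq, S.lam_mul_apply]; rfl)
    (S.V_tensor_gt i) n α x u

theorem W_lam_L (i j : I) (n : ℕ) (α : ContinuousMultilinearMap ℂ (fun _ : Fin (n + 1) => B) B)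
    (x : B) (u : F) :
    S.W i (n + 1) α (S.lam x (S.L j u)) = S.W i n (α.curryLeft (if j = i then x else 0)) u :=
  S.strip_letter i j (S.L i) (S.W i) (S.W_zero i) (S.W_omega i) (S.W_tensor_lt i)
    (fun k α d c => by rw [S.W_tensor_eq, S.L_omega])
    (fun n hn α k d c h => by rw [S.W_tensor_gt i n hn α k d c h, S.L_tensor]) n α x u

theorem apply_eq_of_strip {i j : I} (hij : j ≠ i) {b w y : B} {ω v : F}
    (hω : ω = S.lam w S.Ω + S.lam b (S.L i ω) + S.lam y (S.L j v)) (Q : F →L[ℂ] F)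
    (Z : (n : ℕ) → ContinuousMultilinearMap ℂ (fun _ : Fin n => B) B → (F →L[ℂ] F))
    (hzero : ∀ α, Z 0 α = S.lam (α 0) * Q)
    (hΩ : ∀ n, 1 ≤ n → ∀ α c, Z n α (S.lam c S.Ω) = 0)
    (hstrip : ∀ (j : I) n (α : ContinuousMultilinearMap ℂ (fun _ : Fin (n + 1) => B) B) x u,
      Z (n + 1) α (S.lam x (S.L j u)) = Z n (α.curryLeft (if j = i then x else 0)) u)
    (n : ℕ) (α : ContinuousMultilinearMap ℂ (fun _ : Fin n => B) B) :
    Z n α ω = S.lam (α fun _ => b) (Q ω) := by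
  induction n with
  | zero =>
    rw [hzero, mul_apply_eq_comp, Subsingleton.elim (0 : Fin 0 → B) fun _ => b]
  | succ n ih =>
    have hv : Z (n + 1) α (S.lam y (S.L j v)) = 0 := by
      have h0 := hstrip j n α 0 v
      rw [map_zero, zero_apply, map_zero, if_neg hij] at h0
      rw [hstrip, if_neg hij, ← h0]
    conv_lhs => rw [hω]
    rw [map_add, map_add, hΩ _ (by omega), hv, hstrip, if_pos rfl, ih, zero_add, add_zero,
      ContinuousMultilinearMap.curryLeft_apply]
    congr 3
    ext m
    exact Fin.cases rfl (fun m => rfl) m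

/-- If `ω` reproduces itself under `lam b * L i`, up to a vacuum component and a component
starting with a different letter, then the model operator acts on `ω` as `F(b)(1 + L i)`. -/
theorem model_apply {i j : I} (hij : j ≠ i) {b w y : B} {ω v : F}
    (hω : ω = S.lam w S.Ω + S.lam b (S.L i ω) + S.lam y (S.L j v)) (N : ℕ)
    (α : (n : ℕ) → ContinuousMultilinearMap ℂ (fun _ : Fin n => B) B) :
    (∑ n ∈ Finset.range N, (S.V i n (α n) + S.W i n (α n))) ω =
      S.lam (∑ n ∈ Finset.range N, α n fun _ => b) (ω + S.L i ω) := by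
  rw [_root_.sum_apply, map_sum, _root_.sum_apply]
  refine Finset.sum_congr rfl fun n _ => ?_
  rw [_root_.add_apply, map_add,
    S.apply_eq_of_strip hij hω 1 (S.V i) (fun α => by rw [S.V_zero, mul_one]) (S.V_omega i)
      (fun j n α x u => S.V_lam_L i j n α x u),
    S.apply_eq_of_strip hij hω (S.L i) (S.W i) (S.W_zero i) (S.W_omega i)
      (fun j n α x u => S.W_lam_L i j n α x u)]
  rfl

/-- The left action is automatically continuous, since the operators `V i 1 α` exist. -/
theorem continuous_lam (i : I) : Continuous S.lam := by
  obtain ⟨K, hK⟩ := S.lam.toLinearMap.exists_bound_of_comp_bound (fun T => by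
    let α : ContinuousMultilinearMap ℂ (fun _ : Fin 1 => B) B :=
      (ContinuousMultilinearMap.ofSubsingleton ℂ B B (0 : Fin 1)) T
    refine ⟨‖S.V i 1 α‖ * ‖S.L i‖, fun x => ?_⟩
    have h : S.lam (T x) = S.V i 1 α * (S.lam x * S.L i) := by
      ext u
      rw [mul_apply_eq_comp, mul_apply_eq_comp, S.V_lam_L i i 0 α x u, S.V_zero, if_pos rfl]
      rfl
    change ‖S.lam (T x)‖ ≤ _ * ‖S.lam x‖
    calc ‖S.lam (T x)‖ ≤ ‖S.V i 1 α‖ * (‖S.lam x‖ * ‖S.L i‖) := by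
          rw [h]
          exact (norm_mul_le _ _).trans (by gcongr; exact norm_mul_le _ _)
      _ = _ := by ring)
  exact AddMonoidHomClass.continuous_of_bound S.lam K hK

theorem Psi_eq {X : F →L[ℂ] F} {b c : B} {ω : F} (hu : IsUnit (1 - S.lam c * X))
    (hω : (1 - S.lam c * X) ω = S.Ω) (hP : S.P ω = 1 + b) : S.Psi X c = b := by
  rw [Psi, Ec, ← hω, ← mul_apply_eq_comp, Ring.inverse_mul_cancel _ hu, one_apply_eq_self, hP,
    add_sub_cancel_left]

/-- The S-transform is determined by any right inverse of `Ψ` of the form `b * h b` with `h`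
analytic and invertible at `0`. -/
theorem IsSTransform.eventually_eq {X : F →L[ℂ] F} {Sx h : B → B} (hS : S.IsSTransform X Sx)
    (hh : AnalyticAt ℂ h 0) (hu : IsUnit (h 0)) (hP : ∀ᶠ b in 𝓝 (0 : B), S.Psi X (b * h b) = b) :
    ∀ᶠ b in 𝓝 (0 : B), Sx b = (1 + b) * h b := by
  obtain ⟨H, hH, hHP, hSx⟩ := hS
  have hd : Filter.Tendsto (fun b => b * H b) (𝓝 0) (𝓝 0) := by
    have := (continuousAt_id.mul hH.continuousAt).tendsto
    rwa [Pi.mul_apply, id, zero_mul] at this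
  obtain ⟨u, hu⟩ := hu
  let c' : B ≃L[ℂ] B := ContinuousLinearEquiv.equivOfInverse
    ((ContinuousLinearMap.mul ℂ B).flip u) ((ContinuousLinearMap.mul ℂ B).flip ((u⁻¹ : Bˣ) : B))
    (fun x => by simp [mul_assoc]) (fun x => by simp [mul_assoc])
  have hc : HasStrictFDerivAt (fun b => b * h b) (c' : B →L[ℂ] B) 0 := by
    have h1 := (hasStrictFDerivAt_id (𝕜 := ℂ) (0 : B)).mul' hh.hasStrictFDerivAt
    refine h1.congr_fderiv ?_
    ext x
    simp [c', hu]
  have heq := hc.eventually_eq_of_right_inverse (by simp) hP hd hHP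
  have hz := (hH.sub hh).eventually_eq_zero_of_mul_eq_zero (by
    filter_upwards [heq] with b hb
    rw [Pi.sub_apply, mul_sub, hb, sub_self])
  filter_upwards [hz, hSx] with b h1 h2
  rw [h2, sub_eq_zero.1 h1]

end FockSetup

theorem analyticAt_sum_diagonal (N : ℕ)
    (α : (n : ℕ) → ContinuousMultilinearMap ℂ (fun _ : Fin n => B) B) (b : B) :
    AnalyticAt ℂ (fun b => ∑ n ∈ Finset.range N, α n fun _ => b) b := by
  refine Finset.analyticAt_fun_sum _ fun n _ => ?_
  have h1 : AnalyticAt ℂ (fun b : B => fun _ : Fin n => b) b :=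
    (ContinuousLinearMap.pi fun _ : Fin n => ContinuousLinearMap.id ℂ B).analyticAt b
  exact (α n).cpolynomialAt.analyticAt.comp h1

theorem sum_diagonal_zero (N : ℕ)
    (α : (n : ℕ) → ContinuousMultilinearMap ℂ (fun _ : Fin n => B) B) :
    ∑ n ∈ Finset.range (N + 1), (α n fun _ => (0 : B)) = α 0 0 := by
  rw [Finset.sum_range_succ']
  have : ∀ k ∈ Finset.range N, (α (k + 1) fun _ => (0 : B)) = 0 :=
    fun k _ => (α (k + 1)).map_zero
  rw [Finset.sum_eq_zero this, zero_add]
  exact congrArg _ (Subsingleton.elim _ _)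

theorem AnalyticAt.ring_inverse {E : Type*} [NormedAddCommGroup E] [NormedSpace ℂ E] {f : E → B}
    {x : E} (hf : AnalyticAt ℂ f x) (hu : IsUnit (f x)) :
    AnalyticAt ℂ (fun y => Ring.inverse (f y)) x := by
  obtain ⟨u, hu⟩ := hu
  have h1 := analyticAt_inverse (𝕜 := ℂ) u
  rw [hu] at h1
  exact h1.comp hf

theorem ContinuousAt.eventually_isUnit {A E : Type*} [NormedRing A] [CompleteSpace A]
    [TopologicalSpace E] {f : E → A} {x : E} (hf : ContinuousAt f x) (hu : IsUnit (f x)) :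
    ∀ᶠ y in 𝓝 x, IsUnit (f y) :=
  hf.eventually (Units.isOpen.mem_nhds hu)

theorem mul_inverse_one_add {b : B} (h : IsUnit (1 + b)) :
    b * Ring.inverse (1 + b) = Ring.inverse (1 + b) * b := by
  obtain ⟨u, hu⟩ := h
  rw [← hu, Ring.inverse_unit]
  have h1 : Commute b (u : B) := by
    rw [hu]; exact (Commute.one_right b).add_right (Commute.refl b)
  exact h1.units_inv_right

namespace FockSetup

theorem one_sub_apply_eq_vacuum (S : FockSetup B I F) {X : F →L[ℂ] F} {b c e k : B} {ω r : F}
    (hb : IsUnit (1 + b)) (hX : X ω = S.lam e r) (hc : c * e = Ring.inverse (1 + b) * k)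
    (hr : S.lam k r = S.lam (1 + b) (ω - S.Ω)) : (1 - S.lam c * X) ω = S.Ω := by
  rw [_root_.sub_apply, mul_apply_eq_comp, hX, ← S.lam_mul_apply, hc, S.lam_mul_apply, hr,
    ← S.lam_mul_apply, Ring.inverse_mul_cancel _ hb, map_one, one_apply_eq_self,
    one_apply_eq_self, sub_sub_cancel]

theorem eventually_isUnit_one_sub_lam_mul (S : FockSetup B I F) (i : I) (X : F →L[ℂ] F)
    {h : B → B} (hh : ContinuousAt h 0) :
    ∀ᶠ b in 𝓝 (0 : B), IsUnit (1 - S.lam (b * h b) * X) := by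
  have h1 : ContinuousAt (fun b => S.lam (b * h b)) 0 :=
    (S.continuous_lam i).continuousAt.comp (continuousAt_id.mul hh)
  refine (continuousAt_const.sub (h1.mul continuousAt_const)).eventually_isUnit ?_
  change IsUnit (1 - S.lam (0 * h 0) * X)
  rw [zero_mul, map_zero, zero_mul, sub_zero]
  exact isUnit_one

theorem fixed_point {T : F →L[ℂ] F} (hT : IsUnit (1 - T)) (u : F) :
    Ring.inverse (1 - T) u = u + T (Ring.inverse (1 - T) u) := by
  have h := congrArg (fun R : F →L[ℂ] F => R u) (Ring.mul_inverse_cancel _ hT)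
  rw [← sub_eq_iff_eq_add]
  exact h

/-- The S-transform of a single model operator is `b ↦ F(b)⁻¹`. -/
theorem IsSTransform.model {S : FockSetup B I F} {i j : I} (hij : j ≠ i) {N : ℕ}
    {α : (n : ℕ) → ContinuousMultilinearMap ℂ (fun _ : Fin n => B) B} (hα : IsUnit (α 0 0))
    {Sx : B → B}
    (hS : S.IsSTransform (∑ n ∈ Finset.range (N + 1), (S.V i n (α n) + S.W i n (α n))) Sx) :
    ∀ᶠ b in 𝓝 (0 : B), Sx b = Ring.inverse (∑ n ∈ Finset.range (N + 1), α n fun _ => b) := by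
  set X := ∑ n ∈ Finset.range (N + 1), (S.V i n (α n) + S.W i n (α n))
  set f : B → B := fun b => ∑ n ∈ Finset.range (N + 1), α n fun _ => b with hf
  have hfa : AnalyticAt ℂ f 0 := analyticAt_sum_diagonal (N + 1) α 0
  have hfu : IsUnit (f 0) := by rw [hf]; simpa only [sum_diagonal_zero] using hα
  have h1a : AnalyticAt ℂ (fun b : B => 1 + b) 0 := analyticAt_const.add analyticAt_id
  have h1u : IsUnit (1 + (0 : B)) := by rw [add_zero]; exact isUnit_one
  have hha := (h1a.ring_inverse h1u).mul (hfa.ring_inverse hfu)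
  have hP : ∀ᶠ b in 𝓝 (0 : B),
      S.Psi X (b * (Ring.inverse (1 + b) * Ring.inverse (f b))) = b := by
    filter_upwards [h1a.continuousAt.eventually_isUnit h1u,
      hfa.continuousAt.eventually_isUnit hfu,
      S.eventually_isUnit_one_sub_lam_mul i X hha.continuousAt,
      S.eventually_isUnit_one_sub_lam_mul i (S.L i) (h := fun _ => 1) continuousAt_const]
      with b hb1 hbf hbX hbL
    rw [mul_one] at hbL
    set ω := Ring.inverse (1 - S.lam b * S.L i) (S.lam (1 + b) S.Ω)
    have hω : ω = S.lam (1 + b) S.Ω + S.lam b (S.L i ω) := fixed_point hbL _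
    have hXω : X ω = S.lam (f b) (ω + S.L i ω) :=
      S.model_apply hij (w := 1 + b) (y := 0) (v := 0)
        (by rwa [map_zero S.lam, zero_apply, add_zero]) (N + 1) α
    refine S.Psi_eq hbX (S.one_sub_apply_eq_vacuum (k := b) hb1 hXω ?_ ?_) ?_
    · rw [mul_assoc, mul_assoc, Ring.inverse_mul_cancel _ hbf, mul_one, mul_inverse_one_add hb1]
    · rw [map_add, map_sub, ← sub_eq_iff_eq_add'.2 hω, map_add S.lam 1 b, map_one,
        _root_.add_apply, one_apply_eq_self, _root_.add_apply, one_apply_eq_self]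
      abel
    · rw [hω, map_add, S.P_lam_omega, S.P_lam, S.P_L, mul_zero, add_zero]
  filter_upwards [hS.eventually_eq S hha (by
      exact (h1u.ringInverse).mul hfu.ringInverse) hP,
    h1a.continuousAt.eventually_isUnit h1u] with b hb hb1
  rw [hb, Pi.mul_apply, ← mul_assoc, Ring.mul_inverse_cancel _ hb1, one_mul]

/-- The S-transform of the product of two model operators with distinct indices. -/
theorem IsSTransform.model_mul {S : FockSetup B I F} {i j : I} (hij : j ≠ i) {N : ℕ}
    {α β : (n : ℕ) → ContinuousMultilinearMap ℂ (fun _ : Fin n => B) B} (hα : IsUnit (α 0 0))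
    (hβ : IsUnit (β 0 0)) {Sxy : B → B}
    (hS : S.IsSTransform ((∑ n ∈ Finset.range (N + 1), (S.V i n (α n) + S.W i n (α n))) *
      (∑ n ∈ Finset.range (N + 1), (S.V j n (β n) + S.W j n (β n)))) Sxy) :
    ∀ᶠ b in 𝓝 (0 : B), Sxy b =
      Ring.inverse (∑ n ∈ Finset.range (N + 1), β n (fun _ => b)) *
        Ring.inverse (∑ n ∈ Finset.range (N + 1), α n (fun _ =>
          (∑ m ∈ Finset.range (N + 1), β m (fun _ => b)) * b *
            Ring.inverse (∑ m ∈ Finset.range (N + 1), β m (fun _ => b)))) := by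
  set X := ∑ n ∈ Finset.range (N + 1), (S.V i n (α n) + S.W i n (α n))
  set Y := ∑ n ∈ Finset.range (N + 1), (S.V j n (β n) + S.W j n (β n))
  set f : B → B := fun b => ∑ n ∈ Finset.range (N + 1), α n fun _ => b with hf
  set g : B → B := fun b => ∑ n ∈ Finset.range (N + 1), β n fun _ => b with hg
  change ∀ᶠ b in 𝓝 (0 : B), Sxy b =
    Ring.inverse (g b) * Ring.inverse (f (g b * b * Ring.inverse (g b)))
  have hfu : IsUnit (f 0) := by rw [hf]; simpa only [sum_diagonal_zero] using hα
  have hga : AnalyticAt ℂ g 0 := analyticAt_sum_diagonal (N + 1) β 0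
  have hgu : IsUnit (g 0) := by rw [hg]; simpa only [sum_diagonal_zero] using hβ
  have hgi := hga.ring_inverse hgu
  have hca : AnalyticAt ℂ (fun b => g b * b * Ring.inverse (g b)) 0 :=
    (hga.mul analyticAt_id).mul hgi
  have hc0 : g 0 * 0 * Ring.inverse (g 0) = 0 := by rw [mul_zero, zero_mul]
  have hfa : AnalyticAt ℂ (fun b => f (g b * b * Ring.inverse (g b))) 0 :=
    AnalyticAt.comp (g := f) (analyticAt_sum_diagonal (N + 1) α _) hca
  replace hfu : IsUnit (f (g 0 * 0 * Ring.inverse (g 0))) := by rwa [hc0]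
  have h1a : AnalyticAt ℂ (fun b : B => 1 + b) 0 := analyticAt_const.add analyticAt_id
  have h1u : IsUnit (1 + (0 : B)) := by rw [add_zero]; exact isUnit_one
  have hha := (h1a.ring_inverse h1u).mul (hgi.mul (hfa.ring_inverse hfu))
  have hT : ∀ᶠ b in 𝓝 (0 : B), IsUnit (1 - (S.lam b * S.L j +
      S.lam (b * Ring.inverse (g b)) * (S.L i * (S.lam (g b) * (1 + S.L j))))) := by
    have hl := S.continuous_lam i
    refine ContinuousAt.eventually_isUnit ?_ ?_
    · have h1 : ContinuousAt (fun b => S.lam (b * Ring.inverse (g b))) 0 :=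
        hl.continuousAt.comp (continuousAt_id.mul hgi.continuousAt)
      have h2 : ContinuousAt (fun b => S.lam (g b)) 0 :=
        hl.continuousAt.comp hga.continuousAt
      exact continuousAt_const.sub ((hl.continuousAt.mul continuousAt_const).add
        (h1.mul (continuousAt_const.mul (h2.mul continuousAt_const))))
    · rw [zero_mul, map_zero, zero_mul, zero_mul, add_zero, sub_zero]
      exact isUnit_one
  have hP : ∀ᶠ b in 𝓝 (0 : B), S.Psi (X * Y) (b * (Ring.inverse (1 + b) *
      (Ring.inverse (g b) * Ring.inverse (f (g b * b * Ring.inverse (g b)))))) = b := by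
    filter_upwards [h1a.continuousAt.eventually_isUnit h1u,
      hfa.continuousAt.eventually_isUnit hfu, hga.continuousAt.eventually_isUnit hgu,
      S.eventually_isUnit_one_sub_lam_mul i (X * Y) hha.continuousAt, hT]
      with b hb1 hbf hbg hbX hbT
    set T := S.lam b * S.L j +
      S.lam (b * Ring.inverse (g b)) * (S.L i * (S.lam (g b) * (1 + S.L j)))
    set ω := Ring.inverse (1 - T) (S.lam (1 + b) S.Ω)
    set v := S.lam (g b) (ω + S.L j ω) with hv
    have hω : ω = S.lam (1 + b) S.Ω + S.lam b (S.L j ω) +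
        S.lam (b * Ring.inverse (g b)) (S.L i v) := by
      rw [add_assoc]; exact fixed_point hbT _
    have hYω : Y ω = v := S.model_apply hij.symm hω (N + 1) β
    have hvb : S.lam (b * Ring.inverse (g b)) v = S.lam b (ω + S.L j ω) := by
      rw [hv, ← S.lam_mul_apply, mul_assoc, Ring.inverse_mul_cancel _ hbg, mul_one]
    have hv' : v = S.lam (g b * (1 + b)) S.Ω +
        S.lam (g b * b * Ring.inverse (g b)) (S.L i v) +
        S.lam (g b * b + g b) (S.L j ω) := by
      have h1 : v = S.lam (g b) ω + S.lam (g b) (S.L j ω) := map_add _ _ _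
      have h2 := congrArg (S.lam (g b)) hω
      rw [map_add, map_add, ← S.lam_mul_apply, ← S.lam_mul_apply, ← S.lam_mul_apply,
        ← mul_assoc (g b) b] at h2
      rw [map_add S.lam (g b * b) (g b), _root_.add_apply]
      conv_lhs => rw [h1, h2]
      abel
    have hXω : (X * Y) ω = S.lam (f (g b * b * Ring.inverse (g b))) (v + S.L i v) := by
      rw [mul_apply_eq_comp, hYω]
      exact S.model_apply hij hv' (N + 1) α
    refine S.Psi_eq hbX (S.one_sub_apply_eq_vacuum (k := b * Ring.inverse (g b)) hb1 hXω ?_ ?_) ?_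
    · rw [mul_assoc, mul_assoc, mul_assoc, Ring.inverse_mul_cancel _ hbf, mul_one, ← mul_assoc,
        mul_inverse_one_add hb1, mul_assoc]
    · rw [map_add, hvb, map_sub, ← sub_eq_iff_eq_add'.2 hω, map_add, map_add S.lam 1 b, map_one,
        _root_.add_apply, one_apply_eq_self, _root_.add_apply, one_apply_eq_self]
      abel
    · rw [hω, map_add, map_add, S.P_lam_omega, S.P_lam, S.P_L, S.P_lam, S.P_L, mul_zero, mul_zero,
        add_zero, add_zero]
  filter_upwards [hS.eventually_eq S hha
      (h1u.ringInverse.mul (hgu.ringInverse.mul hfu.ringInverse)) hP,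
    h1a.continuousAt.eventually_isUnit h1u] with b hb hb1
  rw [hb, Pi.mul_apply, Pi.mul_apply, ← mul_assoc, Ring.mul_inverse_cancel _ hb1, one_mul]

end FockSetup

/-- Lemma 3.7: twisted multiplicativity for the model operators.  With
`X = ∑_{n=0}^{N}(V_{1,n}(αₙ) + W_{1,n}(αₙ))`, `Y = ∑_{n=0}^{N}(V_{2,n}(βₙ) + W_{2,n}(βₙ))`
(indices `1, 2 ∈ {1,2}` are `0, 1 : Fin 2`), `F(b) = ∑_{n=0}^N αₙ(b,…,b)` and
`G(b) = ∑_{n=0}^N βₙ(b,…,b)`, one has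
`S_{XY}(b) = G(b)⁻¹ F(G(b) b G(b)⁻¹)⁻¹ = S_Y(b) S_X(S_Y(b)⁻¹ b S_Y(b))` near `0`. -/
theorem stmt_12 (S : FockSetup B (Fin 2) F) (N : ℕ) (hN : 1 ≤ N)
    (α β : (n : ℕ) → ContinuousMultilinearMap ℂ (fun _ : Fin n => B) B)
    (hα : IsUnit (α 0 0)) (hβ : IsUnit (β 0 0))
    (X Y : F →L[ℂ] F)
    (hX : X = ∑ n ∈ Finset.range (N + 1), (S.V 0 n (α n) + S.W 0 n (α n)))
    (hY : Y = ∑ n ∈ Finset.range (N + 1), (S.V 1 n (β n) + S.W 1 n (β n))) :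
    ∀ Sx Sy Sxy : B → B, S.IsSTransform X Sx → S.IsSTransform Y Sy →
      S.IsSTransform (X * Y) Sxy →
      ∀ᶠ b in nhds (0 : B),
        Sxy b =
          Ring.inverse (∑ n ∈ Finset.range (N + 1), β n (fun _ => b)) *
            Ring.inverse (∑ n ∈ Finset.range (N + 1), α n (fun _ =>
              (∑ m ∈ Finset.range (N + 1), β m (fun _ => b)) * b *
                Ring.inverse (∑ m ∈ Finset.range (N + 1), β m (fun _ => b)))) ∧
        Sxy b = Sy b * Sx (Ring.inverse (Sy b) * b * Sy b) := by
  intro Sx Sy Sxy hSx hSy hSxy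
  rw [hX] at hSx
  rw [hY] at hSy
  rw [hX, hY] at hSxy
  have h01 : (1 : Fin 2) ≠ 0 := by decide
  set g : B → B := fun b => ∑ n ∈ Finset.range (N + 1), β n fun _ => b with hg
  have hga : AnalyticAt ℂ g 0 := analyticAt_sum_diagonal (N + 1) β 0
  have hgu : IsUnit (g 0) := by rw [hg]; simpa only [sum_diagonal_zero] using hβ
  have hlim : Filter.Tendsto (fun b => g b * b * Ring.inverse (g b)) (𝓝 0) (𝓝 0) := by
    have h : Filter.Tendsto (fun b => g b * b * Ring.inverse (g b)) (𝓝 0)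
        (𝓝 (g 0 * 0 * Ring.inverse (g 0))) :=
      (hga.continuousAt.mul continuousAt_id).mul (hga.ring_inverse hgu).continuousAt
    rwa [mul_zero, zero_mul] at h
  filter_upwards [hSxy.model_mul h01 hα hβ, hSy.model h01.symm hβ,
    hlim.eventually (hSx.model h01 hα), hga.continuousAt.eventually_isUnit hgu]
    with b hxy hy hx hbg
  refine ⟨hxy, ?_⟩
  have hyg : Sy b = Ring.inverse (g b) := hy
  have hinv : Ring.inverse (Ring.inverse (g b)) = g b := by
    obtain ⟨u, hu⟩ := hbg
    rw [← hu, Ring.inverse_unit, Ring.inverse_unit, inv_inv]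
  rw [hyg, hinv, hx]
  exact hxy
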